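/- Let U and V be τ-rigid modules in mod A with the same Newton polytope, N(U) = N(V). Then the direct sum U ⊕ V is τ-rigid. -/

import Mathlib

/-! Common definitions: finite-dimensional modules over a finite-dimensional algebra,
quotient modules, dimension vectors via composition series, Newton polytopes,
torsion classes, `Fac`, τ-rigidity, bricks, etc. -/

variable (A : Type) [Ring A]

/-- `X` is a quotient module of `M`. -/
def IsQuotientOf (M X : ModuleCat.{0} A) : Prop :=
  ∃ f : M →ₗ[A] X, Function.Surjective f

open Classical in
/-- The dimension vector of a module `M`, relative to a family `S : Fin n → ModuleCat A`
of (representatives of the isomorphism classes of the) simple `A`-modules: its `i`-th entry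
is the multiplicity of `S i` as a composition factor of `M` (well defined by Jordan–Hölder,
for `M` of finite length). -/
noncomputable def dimVec {n : ℕ} (S : Fin n → ModuleCat.{0} A)
    (M : Type) [AddCommGroup M] [Module A M] : Fin n → ℕ := fun i =>
  if h : ∃ s : CompositionSeries (Submodule A M),
      RelSeries.head s = ⊥ ∧ RelSeries.last s = ⊤ then
    Nat.card {j : Fin h.choose.length //
      Nonempty ((↥(h.choose j.succ) ⧸
        (Submodule.comap (h.choose j.succ).subtype
          (h.choose j.castSucc))) ≃ₗ[A] S i)}
  else 0

/-- The Newton polytope of `U`: the convex hull in `ℝⁿ` of the dimension vectors of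
the quotient modules of `U`. -/
noncomputable def newtonPolytope {n : ℕ} (S : Fin n → ModuleCat.{0} A)
    (U : ModuleCat.{0} A) : Set (Fin n → ℝ) :=
  convexHull ℝ { v : Fin n → ℝ | ∃ p : Submodule A U,
    v = fun i => ((dimVec A S (↥U ⧸ p) i : ℕ) : ℝ) }

/-- `Fac M`: the class of quotient modules of finite direct sums of copies of `M`. -/
def Fac (M : ModuleCat.{0} A) : Set (ModuleCat.{0} A) :=
  { X | ∃ (k : ℕ) (f : (Fin k → M) →ₗ[A] X), Function.Surjective f }

/-- A torsion class in `mod A`: a class of finite-dimensional `A`-modules closed under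
isomorphisms, quotient modules and extensions. -/
def IsTorsionClass (T : Set (ModuleCat.{0} A)) : Prop :=
  (∀ M ∈ T, Module.Finite A M) ∧
  (∀ M ∈ T, ∀ N : ModuleCat.{0} A, Nonempty (M ≃ₗ[A] N) → N ∈ T) ∧
  (∀ M ∈ T, ∀ X : ModuleCat.{0} A, IsQuotientOf A M X → X ∈ T) ∧
  (∀ (L E N : ModuleCat.{0} A) (f : L →ₗ[A] E) (g : E →ₗ[A] N),
    Function.Injective f → Function.Surjective g →
    LinearMap.range f = LinearMap.ker g → L ∈ T → N ∈ T → E ∈ T)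

/-- `⟨N⟩_tors`, the smallest torsion class containing `N`. -/
def torsGen (N : ModuleCat.{0} A) : Set (ModuleCat.{0} A) :=
  ⋂₀ { T | IsTorsionClass A T ∧ N ∈ T }

/-- A module `N` is left finite if the torsion class it generates is functorially finite,
i.e. `⟨N⟩_tors = Fac M` for some `M` in `mod A`. -/
def LeftFinite (N : ModuleCat.{0} A) : Prop :=
  ∃ M : ModuleCat.{0} A, Module.Finite A M ∧ torsGen A N = Fac A M

/-- `M` is τ-rigid: `Ext¹(M, X) = 0` for every `X ∈ Fac M`, expressed by the splitting of
every short exact sequence `0 → X → E → M → 0`. -/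
def IsTauRigid (M : ModuleCat.{0} A) : Prop :=
  ∀ X ∈ Fac A M, ∀ (E : ModuleCat.{0} A) (f : X →ₗ[A] E) (g : E →ₗ[A] M),
    Function.Injective f → Function.Surjective g → LinearMap.range f = LinearMap.ker g →
    ∃ s : M →ₗ[A] E, g.comp s = LinearMap.id

/-- `M` is indecomposable. -/
def Indecomposable (M : ModuleCat.{0} A) : Prop :=
  Nontrivial M ∧ ∀ (M₁ M₂ : ModuleCat.{0} A),
    Nonempty (M ≃ₗ[A] (M₁ × M₂)) → (Subsingleton M₁ ∨ Subsingleton M₂)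

/-- `M` is a brick: its endomorphism ring is a division ring, i.e. `M ≠ 0` and every
nonzero endomorphism of `M` is invertible. -/
def IsBrick (M : ModuleCat.{0} A) : Prop :=
  Nontrivial M ∧ ∀ f : M →ₗ[A] M, f ≠ 0 → Function.Bijective f

section ExtendsAlong

variable {A} {P₁ P₀ X Y : Type} [AddCommGroup P₁] [Module A P₁] [AddCommGroup P₀] [Module A P₀]
  [AddCommGroup X] [Module A X] [AddCommGroup Y] [Module A Y]

variable (X) in
/-- Every linear map `P₁ → X` factors through `d : P₁ → P₀`. When `d` is a minimal projective
presentation of `U`, this says that `Hom(X, τU) = 0`. -/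
def ExtendsAlong (d : P₁ →ₗ[A] P₀) : Prop :=
  ∀ f : P₁ →ₗ[A] X, ∃ g : P₀ →ₗ[A] X, g ∘ₗ d = f

namespace ExtendsAlong

variable {d : P₁ →ₗ[A] P₀}

theorem of_surjective [Module.Projective A P₁] (h : ExtendsAlong X d) (q : X →ₗ[A] Y)
    (hq : Function.Surjective q) : ExtendsAlong Y d := by
  intro f
  obtain ⟨f', rfl⟩ := Module.projective_lifting_property q f hq
  obtain ⟨g, rfl⟩ := h f'
  exact ⟨q ∘ₗ g, by rw [LinearMap.comp_assoc]⟩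

theorem of_submodule_of_quotient [Module.Projective A P₀] (N : Submodule A X)
    (hN : ExtendsAlong N d) (hQ : ExtendsAlong (X ⧸ N) d) : ExtendsAlong X d := by
  intro f
  obtain ⟨g', hg'⟩ := hQ (N.mkQ ∘ₗ f)
  obtain ⟨g, rfl⟩ := Module.projective_lifting_property N.mkQ g' N.mkQ_surjective
  have hmem : ∀ p, (f - g ∘ₗ d) p ∈ N := by
    intro p
    have := LinearMap.congr_fun hg' p
    rw [← Submodule.ker_mkQ N, LinearMap.mem_ker]
    simpa [sub_eq_zero] using this.symm
  obtain ⟨c, hc⟩ := hN ((f - g ∘ₗ d).codRestrict N hmem)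
  refine ⟨g + N.subtype ∘ₗ c, ?_⟩
  ext p
  have := congrArg Subtype.val (LinearMap.congr_fun hc p)
  simp at this
  simp [this]

theorem prod (hX : ExtendsAlong X d) (hY : ExtendsAlong Y d) : ExtendsAlong (X × Y) d := by
  intro f
  obtain ⟨g, hg⟩ := hX (LinearMap.fst A X Y ∘ₗ f)
  obtain ⟨h, hh⟩ := hY (LinearMap.snd A X Y ∘ₗ f)
  refine ⟨g.prod h, ?_⟩
  ext p
  · simpa using LinearMap.congr_fun hg p
  · simpa using LinearMap.congr_fun hh p

theorem of_mem_Fac [Module.Projective A P₁] {M X : ModuleCat.{0} A} (hM : ExtendsAlong M d)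
    (hX : X ∈ Fac A M) : ExtendsAlong X d := by
  obtain ⟨k, q, hq⟩ := hX
  exact of_surjective (fun f => by
    choose g hg using fun i => hM (LinearMap.proj i ∘ₗ f)
    refine ⟨LinearMap.pi g, LinearMap.ext fun p => funext fun i => ?_⟩
    simpa using LinearMap.congr_fun (hg i) p) q hq

/-- If `P₁ → P₀ → U → 0` is exact and `X` extends along `P₁ → P₀`, then maps out of `U` lift along
surjections with kernel `X`. -/
theorem exists_lift [Module.Projective A P₀] {U E W : Type} [AddCommGroup U] [Module A U]
    [AddCommGroup E] [Module A E] [AddCommGroup W] [Module A W]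
    (hX : ExtendsAlong X d) {π : P₀ →ₗ[A] U} (hπ : Function.Surjective π)
    (hd : LinearMap.range d = LinearMap.ker π) {f : X →ₗ[A] E} {g : E →ₗ[A] W}
    (hf : Function.Injective f) (hg : Function.Surjective g)
    (hfg : LinearMap.range f = LinearMap.ker g) (φ : U →ₗ[A] W) :
    ∃ s : U →ₗ[A] E, g ∘ₗ s = φ := by
  have hgf : ∀ x, g (f x) = 0 := fun x =>
    LinearMap.mem_ker.1 (hfg ▸ LinearMap.mem_range_self f x)
  have hπd : ∀ p, π (d p) = 0 := fun p =>
    LinearMap.mem_ker.1 (hd ▸ LinearMap.mem_range_self d p)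
  obtain ⟨a, ha⟩ := Module.projective_lifting_property g (φ ∘ₗ π) hg
  have ha' : ∀ p, g (a p) = φ (π p) := fun p => LinearMap.congr_fun ha p
  have hmem : ∀ p, (a ∘ₗ d) p ∈ LinearMap.range f := by
    intro p
    rw [hfg, LinearMap.mem_ker, LinearMap.comp_apply, ha', hπd, map_zero]
  let e := LinearEquiv.ofInjective f hf
  obtain ⟨c, hc⟩ := hX (e.symm.toLinearMap ∘ₗ (a ∘ₗ d).codRestrict _ hmem)
  have hc' : ∀ p, f (c (d p)) = a (d p) := by
    intro p
    have h1 : c (d p) = e.symm _ := LinearMap.congr_fun hc p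
    have h2 := congrArg Subtype.val (e.apply_symm_apply ((a ∘ₗ d).codRestrict _ hmem p))
    rw [← h1] at h2
    simpa [e] using h2
  have hker : LinearMap.ker π ≤ LinearMap.ker (a - f ∘ₗ c) := by
    rw [← hd]
    rintro _ ⟨p, rfl⟩
    simp [hc']
  obtain ⟨r, hr⟩ := hπ.hasRightInverse
  refine ⟨(LinearMap.ker π).liftQ _ hker ∘ₗ (π.quotKerEquivOfSurjective hπ).symm.toLinearMap, ?_⟩
  ext u
  obtain ⟨p, rfl⟩ := hπ u
  have : (π.quotKerEquivOfSurjective hπ).symm (π p) = (LinearMap.ker π).mkQ p := by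
    rw [LinearEquiv.symm_apply_eq]
    simp
  simp [this, ha', hgf]

end ExtendsAlong

/-- A τ-rigid module extends along its minimal projective presentation. -/
theorem IsTauRigid.extendsAlong [Module.Projective A P₀] {U : ModuleCat.{0} A} [IsArtinian A U]
    (hU : IsTauRigid A U) {d : P₁ →ₗ[A] P₀} {π : P₀ →ₗ[A] U} (hπ : Function.Surjective π)
    (hd : LinearMap.range d = LinearMap.ker π)
    (hmin : ∀ N : Submodule A P₁, N ⊔ LinearMap.ker d = ⊤ → N = ⊤) :
    ExtendsAlong U d := by
  have hπd : ∀ p, π (d p) = 0 := fun p =>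
    LinearMap.mem_ker.1 (hd ▸ LinearMap.mem_range_self d p)
  have key : ∀ f : P₁ →ₗ[A] U, ∃ g : P₀ →ₗ[A] U,
      LinearMap.range (f - g ∘ₗ d) ≤ (LinearMap.ker d).map f := by
    intro f
    let L := (LinearMap.ker d).map f
    let R := LinearMap.range ((L.mkQ ∘ₗ f).prod (-d))
    let i : (U ⧸ L) →ₗ[A] ((U ⧸ L) × P₀) ⧸ R := R.mkQ ∘ₗ LinearMap.inl A _ _
    have hR : R ≤ LinearMap.ker (π ∘ₗ LinearMap.snd A (U ⧸ L) P₀) := by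
      rintro _ ⟨p, rfl⟩
      simp [hπd]
    let q : (((U ⧸ L) × P₀) ⧸ R) →ₗ[A] U := R.liftQ _ hR
    have hi : Function.Injective i := by
      rw [← LinearMap.ker_eq_bot, LinearMap.ker_eq_bot']
      intro y hy
      have : (y, (0 : P₀)) ∈ R := by simpa [i] using hy
      obtain ⟨p, hp⟩ := this
      have h1 : L.mkQ (f p) = y := congrArg Prod.fst hp
      have h2 : - d p = 0 := congrArg Prod.snd hp
      rw [← h1, ← LinearMap.mem_ker, Submodule.ker_mkQ]
      exact Submodule.mem_map_of_mem (by simpa using h2)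
    have hq : Function.Surjective q := by
      intro u
      obtain ⟨p, rfl⟩ := hπ u
      exact ⟨R.mkQ (0, p), by simp [q]⟩
    have hqi : ∀ e, q e = 0 → ∃ y, i y = e := by
      intro e he
      obtain ⟨⟨y, p⟩, rfl⟩ := R.mkQ_surjective e
      have hp : p ∈ LinearMap.range d := by
        rw [hd]
        simpa [q] using he
      obtain ⟨p, rfl⟩ := hp
      refine ⟨y + L.mkQ (f p), ?_⟩
      rw [← sub_eq_zero]
      simp only [i, LinearMap.comp_apply, ← map_sub]
      rw [← LinearMap.mem_ker, Submodule.ker_mkQ]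
      exact ⟨p, by simp⟩
    have hex : LinearMap.range i = LinearMap.ker q := by
      apply le_antisymm
      · rintro _ ⟨y, rfl⟩
        simp [i, q]
      · intro e he
        exact hqi e he
    obtain ⟨s, hs⟩ := hU (ModuleCat.of A (U ⧸ L))
      ⟨1, L.mkQ ∘ₗ LinearMap.proj 0, L.mkQ_surjective.comp fun u => ⟨fun _ => u, rfl⟩⟩
      (ModuleCat.of A (((U ⧸ L) × P₀) ⧸ R)) i q hi hq hex
    have hs' : ∀ u, q (s u) = u := fun u => LinearMap.congr_fun hs u
    have hmem : ∀ p, (R.mkQ ∘ₗ LinearMap.inr A (U ⧸ L) P₀ - s ∘ₗ π) p ∈ LinearMap.range i := by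
      intro p
      rw [hex, LinearMap.mem_ker, LinearMap.sub_apply, map_sub]
      simp only [LinearMap.comp_apply, hs']
      simp [q]
    let e := LinearEquiv.ofInjective i hi
    let g' : P₀ →ₗ[A] (U ⧸ L) := e.symm.toLinearMap ∘ₗ LinearMap.codRestrict _ _ hmem
    have hg' : ∀ p, i (g' p) = R.mkQ (0, p) - s (π p) := by
      intro p
      simp [e, g']
    obtain ⟨g, hg⟩ := Module.projective_lifting_property L.mkQ g' L.mkQ_surjective
    refine ⟨g, ?_⟩
    rintro _ ⟨p, rfl⟩
    change _ ∈ L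
    rw [← Submodule.ker_mkQ L, LinearMap.mem_ker, LinearMap.sub_apply, map_sub, sub_eq_zero]
    apply hi
    have hgp : L.mkQ (g (d p)) = g' (d p) := LinearMap.congr_fun hg (d p)
    change i (L.mkQ (f p)) = i (L.mkQ (g (d p)))
    rw [hgp, hg', hπd, map_zero, sub_zero, ← sub_eq_zero]
    simp only [i, LinearMap.comp_apply, ← map_sub]
    rw [← LinearMap.mem_ker, Submodule.ker_mkQ]
    exact ⟨p, by simp⟩
  suffices ∀ (W : Submodule A U) (f : P₁ →ₗ[A] U), LinearMap.range f = W →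
      ∃ g : P₀ →ₗ[A] U, g ∘ₗ d = f from fun f => this _ f rfl
  intro W
  induction W using WellFoundedLT.induction with
  | ind W ih =>
    rintro f rfl
    by_cases hf : f = 0
    · exact ⟨0, by simp [hf]⟩
    obtain ⟨g, hg⟩ := key f
    have hlt : (LinearMap.ker d).map f < LinearMap.range f := by
      refine lt_of_le_of_ne LinearMap.map_le_range fun h => hf ?_
      rw [← LinearMap.ker_eq_top]
      apply hmin
      rw [sup_comm, ← Submodule.comap_map_eq, h, eq_top_iff]
      exact fun p _ => LinearMap.mem_range_self f p
    obtain ⟨c, hc⟩ := ih _ (hg.trans_lt hlt) _ rfl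
    exact ⟨g + c, by rw [LinearMap.add_comp, hc]; abel⟩

/-- Over an artinian ring every finite module has a projective cover. -/
theorem exists_projective_cover [IsArtinianRing A] (W : Type) [AddCommGroup W] [Module A W]
    [Module.Finite A W] :
    ∃ (P : ModuleCat.{0} A) (_ : Module.Projective A P) (_ : Module.Finite A P) (π : P →ₗ[A] W),
      Function.Surjective π ∧ ∀ N : Submodule A P, N ⊔ LinearMap.ker π = ⊤ → N = ⊤ := by
  obtain ⟨m, ρ, hρ⟩ := Module.Finite.exists_fin' A W
  obtain ⟨Q, ⟨hQp, hQ⟩, hmin⟩ := IsWellFounded.wf (r := (· < · : Submodule A (Fin m → A) → _ → Prop))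
    |>.has_min {Q | Module.Projective A Q ∧ Q.map ρ = ⊤}
    ⟨⊤, Module.Projective.of_equiv Submodule.topEquiv.symm, by
      rw [Submodule.map_top, LinearMap.range_eq_top.2 hρ]⟩
  let π : Q →ₗ[A] W := ρ ∘ₗ Q.subtype
  have hπ : Function.Surjective π := by
    intro w
    have : w ∈ Q.map ρ := hQ ▸ Submodule.mem_top
    obtain ⟨x, hx, rfl⟩ := this
    exact ⟨⟨x, hx⟩, rfl⟩
  refine ⟨ModuleCat.of A Q, hQp, inferInstanceAs (Module.Finite A Q), π, hπ, fun N hN => ?_⟩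
  change Submodule A Q at N
  have hπN : Function.Surjective (π ∘ₗ N.subtype) := by
    rw [← LinearMap.range_eq_top, LinearMap.range_comp, Submodule.range_subtype]
    have : (N ⊔ LinearMap.ker π).map π = ⊤ := by
      erw [hN]
      rw [Submodule.map_top, LinearMap.range_eq_top.2 hπ]
    rwa [Submodule.map_sup, LinearMap.le_ker_iff_map.1 le_rfl, sup_bot_eq] at this
  obtain ⟨φ', hφ'⟩ := Module.projective_lifting_property _ π hπN
  let φ : Module.End A Q := N.subtype ∘ₗ φ'
  have hφ : ∀ x, π (φ x) = π x := fun x => LinearMap.congr_fun hφ' x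
  have hφn : ∀ (k : ℕ) x, π ((φ ^ k) x) = π x := by
    intro k
    induction k with
    | zero => simp
    | succ k ih => intro x; rw [pow_succ', Module.End.mul_apply, hφ, ih]
  obtain ⟨k, hk⟩ := (φ.eventually_isCompl_ker_pow_range_pow).exists_forall_of_atTop
  specialize hk (k + 1) (by omega)
  let Q₁ := LinearMap.range (φ ^ (k + 1))
  have hQ₁N : Q₁ ≤ N := by
    rintro _ ⟨x, rfl⟩
    rw [pow_succ', Module.End.mul_apply]
    exact (φ' _).2
  have hQ₁ : Module.Projective A Q₁ :=
    Module.Projective.of_split Q₁.subtype (Q₁.projectionOnto _ hk.symm)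
      (LinearMap.ext fun x => Submodule.projectionOnto_apply_left hk.symm x)
  have hnot := hmin (Q₁.map Q.subtype) ⟨
    Module.Projective.of_equiv (Submodule.equivMapOfInjective Q.subtype Q.subtype_injective Q₁), by
      rw [eq_top_iff]
      intro w _
      obtain ⟨x, rfl⟩ := hπ w
      exact ⟨_, ⟨_, ⟨x, rfl⟩, rfl⟩, hφn (k + 1) x⟩⟩
  have heq : Q₁.map Q.subtype = Q :=
    (Submodule.map_subtype_le Q Q₁).eq_of_not_lt hnot
  rw [eq_top_iff]
  intro x _
  have hx : (x : Fin m → A) ∈ Q₁.map Q.subtype := by rw [heq]; exact x.2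
  obtain ⟨y, hy, hyx⟩ := hx
  have : y = x := Subtype.ext hyx
  exact hQ₁N (this ▸ hy)

end ExtendsAlong

section HomDimension

variable {A} {K : Type} [Field K] [Algebra K A] {P : Type} [AddCommGroup P] [Module A P]

theorem finite_linearMap_of_finite [Module.Finite A P] (M : Type) [AddCommGroup M] [Module A M]
    [Module K M] [IsScalarTower K A M] [Module.Finite K M] : Module.Finite K (P →ₗ[A] M) := by
  obtain ⟨m, ρ, hρ⟩ := Module.Finite.exists_fin' A P
  let ev : (P →ₗ[A] M) →ₗ[K] (Fin m → M) :=
    { toFun := fun f i => f (ρ (Pi.single i 1))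
      map_add' := fun _ _ => rfl
      map_smul' := fun _ _ => rfl }
  refine Module.Finite.of_injective ev fun f g h => ?_
  rw [← LinearMap.cancel_right hρ]
  ext i
  exact congrFun h i

theorem finrank_linearMap_congr {M N : Type} [AddCommGroup M] [Module A M] [Module K M]
    [IsScalarTower K A M] [AddCommGroup N] [Module A N] [Module K N] [IsScalarTower K A N]
    (e : M ≃ₗ[A] N) : Module.finrank K (P →ₗ[A] M) = Module.finrank K (P →ₗ[A] N) := by
  have hK : ∀ (k : K) (x : M), e (k • x) = k • e x := fun k x => by
    rw [← algebraMap_smul A k x, map_smul, algebraMap_smul]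
  refine LinearEquiv.finrank_eq
    { toFun := fun f => e.toLinearMap ∘ₗ f
      invFun := fun f => e.symm.toLinearMap ∘ₗ f
      map_add' := fun f g => by ext; simp
      map_smul' := fun k f => by ext x; simp [hK]
      left_inv := fun f => by ext; simp
      right_inv := fun f => by ext; simp }

theorem finrank_linearMap_eq_add [Module.Projective A P] [Module.Finite A P] {N M L : Type}
    [AddCommGroup N] [Module A N] [Module K N] [IsScalarTower K A N]
    [AddCommGroup M] [Module A M] [Module K M] [IsScalarTower K A M] [Module.Finite K M]
    [AddCommGroup L] [Module A L] [Module K L] [IsScalarTower K A L]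
    (i : N →ₗ[A] M) (q : M →ₗ[A] L) (hi : Function.Injective i) (hq : Function.Surjective q)
    (hex : LinearMap.range i = LinearMap.ker q) :
    Module.finrank K (P →ₗ[A] M) =
      Module.finrank K (P →ₗ[A] N) + Module.finrank K (P →ₗ[A] L) := by
  have := finite_linearMap_of_finite (A := A) (K := K) (P := P) M
  have hiK : ∀ (k : K) x, i (k • x) = k • i x := fun k x => by
    rw [← algebraMap_smul A k x, map_smul, algebraMap_smul]
  have hqK : ∀ (k : K) x, q (k • x) = k • q x := fun k x => by
    rw [← algebraMap_smul A k x, map_smul, algebraMap_smul]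
  let I : (P →ₗ[A] N) →ₗ[K] (P →ₗ[A] M) :=
    { toFun := fun f => i ∘ₗ f
      map_add' := fun f g => by ext; simp
      map_smul' := fun k f => by ext x; simp [hiK] }
  let Q : (P →ₗ[A] M) →ₗ[K] (P →ₗ[A] L) :=
    { toFun := fun f => q ∘ₗ f
      map_add' := fun f g => by ext; simp
      map_smul' := fun k f => by ext x; simp [hqK] }
  have hI : Function.Injective I := fun f g h => LinearMap.ext fun x => hi (LinearMap.congr_fun h x)
  have hQ : LinearMap.range Q = ⊤ := LinearMap.range_eq_top.2 fun f =>
    Module.projective_lifting_property q f hq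
  have hIQ : LinearMap.ker Q = LinearMap.range I := by
    apply le_antisymm
    · intro f hf
      have hmem : ∀ p, f p ∈ LinearMap.range i := fun p => by
        rw [hex]
        exact LinearMap.congr_fun (LinearMap.mem_ker.1 hf) p
      refine ⟨(LinearEquiv.ofInjective i hi).symm.toLinearMap ∘ₗ f.codRestrict _ hmem, ?_⟩
      ext p
      exact congrArg Subtype.val
        ((LinearEquiv.ofInjective i hi).apply_symm_apply (f.codRestrict _ hmem p))
    · rintro _ ⟨f, rfl⟩
      rw [LinearMap.mem_ker]
      ext p
      have hp : i (f p) ∈ LinearMap.ker q := hex ▸ LinearMap.mem_range_self i (f p)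
      exact hp
  have h := LinearMap.finrank_range_add_finrank_ker Q
  rw [hQ, hIQ, finrank_top, LinearMap.finrank_range_of_inj hI] at h
  omega

theorem finrank_linearMap_compositionSeries [Module.Projective A P] [Module.Finite A P] {M : Type}
    [AddCommGroup M] [Module A M] [Module K M] [IsScalarTower K A M] [Module.Finite K M]
    (s : CompositionSeries (Submodule A M)) (h₀ : RelSeries.head s = ⊥)
    (h₁ : RelSeries.last s = ⊤) :
    Module.finrank K (P →ₗ[A] M) = ∑ j : Fin s.length, Module.finrank K (P →ₗ[A]
      (↥(s j.succ) ⧸ Submodule.comap (s j.succ).subtype (s j.castSucc))) := by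
  have step : ∀ j : Fin s.length, Module.finrank K (P →ₗ[A] ↥(s j.succ)) =
      Module.finrank K (P →ₗ[A] ↥(s j.castSucc)) + Module.finrank K (P →ₗ[A]
        (↥(s j.succ) ⧸ Submodule.comap (s j.succ).subtype (s j.castSucc))) := by
    intro j
    have hle : s j.castSucc ≤ s j.succ := (s.step j).le
    have : Module.Finite K ↥(s j.succ) :=
      inferInstanceAs (Module.Finite K ((s j.succ).restrictScalars K))
    refine finrank_linearMap_eq_add (Submodule.inclusion hle) (Submodule.mkQ _)
      (Submodule.inclusion_injective hle) (Submodule.mkQ_surjective _) ?_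
    rw [Submodule.ker_mkQ, Submodule.range_inclusion]
  have hsum : ∀ (m : ℕ) (a : Fin (m + 1) → ℕ) (b : Fin m → ℕ),
      (∀ j, a j.succ = a j.castSucc + b j) → a (Fin.last m) = a 0 + ∑ j, b j := by
    intro m
    induction m with
    | zero => intro a b _; simp
    | succ m ih =>
      intro a b h
      rw [Fin.sum_univ_castSucc, ← Fin.succ_last, h, ← add_assoc]
      congr 1
      exact ih (fun j => a j.castSucc) (fun j => b j.castSucc) fun j => h j.castSucc
  have := hsum s.length (fun j => Module.finrank K (P →ₗ[A] ↥(s j))) _ step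
  have hbot : s 0 = ⊥ := h₀
  have htop : s (Fin.last _) = ⊤ := h₁
  simp only at this
  have e0 : Module.finrank K (P →ₗ[A] ↥(s 0)) = 0 := by
    rw [hbot]
    exact Module.finrank_zero_of_subsingleton
  have e1 : Module.finrank K (P →ₗ[A] ↥(s (Fin.last _))) = Module.finrank K (P →ₗ[A] M) := by
    rw [htop]
    exact finrank_linearMap_congr Submodule.topEquiv
  rw [← e1, this, e0, zero_add]

theorem finrank_linearMap_eq_sum_dimVec [Module.Projective A P] [Module.Finite A P] {M : Type}
    [FiniteDimensional K A]
    [AddCommGroup M] [Module A M] [Module K M] [IsScalarTower K A M] [Module.Finite K M]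
    {n : ℕ} (S : Fin n → ModuleCat.{0} A) [∀ i, Module K (S i)] [∀ i, IsScalarTower K A (S i)]
    (hdistinct : ∀ i j, Nonempty ((S i : Type) ≃ₗ[A] (S j : Type)) → i = j)
    (hcomplete : ∀ M : ModuleCat.{0} A, IsSimpleModule A M → ∃ i, Nonempty (M ≃ₗ[A] S i)) :
    Module.finrank K (P →ₗ[A] M) =
      ∑ i, dimVec A S M i * Module.finrank K (P →ₗ[A] S i) := by
  classical
  have : IsArtinianRing A := IsArtinianRing.of_finite K A
  have : Module.Finite A M := Module.Finite.of_restrictScalars_finite K A M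
  have hs : ∃ s : CompositionSeries (Submodule A M),
      RelSeries.head s = ⊥ ∧ RelSeries.last s = ⊤ :=
    exists_compositionSeries_of_isNoetherian_isArtinian A M
  simp only [dimVec, dif_pos hs]
  rw [finrank_linearMap_compositionSeries hs.choose hs.choose_spec.1 hs.choose_spec.2]
  generalize hs.choose = s
  have hfac : ∀ j : Fin s.length, Module.finrank K (P →ₗ[A]
      (↥(s j.succ) ⧸ Submodule.comap (s j.succ).subtype (s j.castSucc))) =
      ∑ i, if Nonempty ((↥(s j.succ) ⧸
        Submodule.comap (s j.succ).subtype (s j.castSucc)) ≃ₗ[A] S i) then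
        Module.finrank K (P →ₗ[A] S i) else 0 := by
    intro j
    have hsimp : IsSimpleModule A
        (↥(s j.succ) ⧸ Submodule.comap (s j.succ).subtype (s j.castSucc)) :=
      (covBy_iff_quot_is_simple (s.step j).le).1 (s.step j)
    obtain ⟨i, ⟨e⟩⟩ := hcomplete (ModuleCat.of A _) hsimp
    rw [Finset.sum_eq_single i, if_pos ⟨e⟩]
    · exact finrank_linearMap_congr e
    · rintro i' - hne
      rw [if_neg]
      rintro ⟨e'⟩
      exact hne (hdistinct _ _ ⟨e'.symm.trans e⟩)
    · simp
  simp_rw [hfac]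
  rw [Finset.sum_comm]
  refine Finset.sum_congr rfl fun i _ => ?_
  rw [← Finset.sum_filter, Finset.sum_const, smul_eq_mul, Nat.card_eq_fintype_card,
    Fintype.card_subtype]

end HomDimension

/-- If `U` extends along its own projective presentation, then so does every module with the same
Newton polytope. -/
theorem ExtendsAlong.of_newtonPolytope_eq {A : Type} [Ring A] {K : Type} [Field K] [Algebra K A]
    [FiniteDimensional K A] {n : ℕ} {S : Fin n → ModuleCat.{0} A}
    (hdistinct : ∀ i j, Nonempty ((S i : Type) ≃ₗ[A] (S j : Type)) → i = j)
    (hcomplete : ∀ M : ModuleCat.{0} A, IsSimpleModule A M → ∃ i, Nonempty (M ≃ₗ[A] S i))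
    {U V : ModuleCat.{0} A} [Module.Finite A U] [Module.Finite A V]
    (hNewton : newtonPolytope A S U = newtonPolytope A S V)
    {P₁ P₀ : Type} [AddCommGroup P₁] [Module A P₁] [AddCommGroup P₀] [Module A P₀]
    [Module.Projective A P₁] [Module.Finite A P₁] [Module.Projective A P₀] [Module.Finite A P₀]
    {d : P₁ →ₗ[A] P₀} {π : P₀ →ₗ[A] U} (hπ : Function.Surjective π)
    (hd : LinearMap.range d = LinearMap.ker π) (hU : ExtendsAlong U d) :
    ExtendsAlong V d := by
  let (M : ModuleCat.{0} A) : Module K M := Module.compHom M (algebraMap K A)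
  have (M : ModuleCat.{0} A) : IsScalarTower K A M :=
    ⟨fun k a x => by rw [Algebra.smul_def, mul_smul]; rfl⟩
  have : IsArtinianRing A := IsArtinianRing.of_finite K A
  have : Module.Finite K U := Module.Finite.trans A U
  have : Module.Finite K V := Module.Finite.trans A V
  let pre (X : Type) [AddCommGroup X] [Module A X] [Module K X] [IsScalarTower K A X] :
      (P₀ →ₗ[A] X) →ₗ[K] (P₁ →ₗ[A] X) :=
    { toFun := fun f => f ∘ₗ d
      map_add' := fun _ _ => rfl
      map_smul' := fun _ _ => rfl }
  let ℓ : (Fin n → ℝ) →ₗ[ℝ] ℝ := ∑ i, ((Module.finrank K (P₀ →ₗ[A] S i) : ℝ) -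
    Module.finrank K (P₁ →ₗ[A] S i)) • LinearMap.proj i
  have hℓ : ∀ (X : Type) [AddCommGroup X] [Module A X] [Module K X] [IsScalarTower K A X]
      [Module.Finite K X], ℓ (fun i => ((dimVec A S X i : ℕ) : ℝ)) =
        (Module.finrank K (P₀ →ₗ[A] X) : ℝ) - Module.finrank K (P₁ →ₗ[A] X) := by
    intro X _ _ _ _ _
    rw [finrank_linearMap_eq_sum_dimVec (P := P₀) S hdistinct hcomplete,
      finrank_linearMap_eq_sum_dimVec (P := P₁) S hdistinct hcomplete]
    push_cast
    rw [← Finset.sum_sub_distrib]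
    simp only [ℓ, LinearMap.sum_apply, LinearMap.smul_apply, LinearMap.proj_apply, smul_eq_mul]
    exact Finset.sum_congr rfl fun i _ => by ring
  have hNU : newtonPolytope A S U ⊆ {v | 0 ≤ ℓ v} := by
    refine convexHull_min ?_ (convex_halfSpace_ge ℓ.isLinear 0)
    rintro _ ⟨p, rfl⟩
    rw [Set.mem_ofPred_eq, hℓ, sub_nonneg, Nat.cast_le]
    have := finite_linearMap_of_finite (A := A) (K := K) (P := P₀) (U ⧸ p)
    exact LinearMap.finrank_le_finrank_of_surjective (f := pre (U ⧸ p))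
      (hU.of_surjective p.mkQ p.mkQ_surjective)
  have hV : ∀ p : Submodule A V, ExtendsAlong (V ⧸ p) d := by
    intro p
    induction p using WellFoundedGT.induction with
    | ind p ih =>
      by_contra hp
      have hzero : ∀ f : U →ₗ[A] (V ⧸ p), f = 0 := by
        intro f
        by_contra hf
        apply hp
        refine ExtendsAlong.of_submodule_of_quotient (LinearMap.range f)
          (hU.of_surjective f.rangeRestrict f.surjective_rangeRestrict) ?_
        let q := (LinearMap.range f).mkQ ∘ₗ p.mkQ
        have hq : Function.Surjective q :=
          (LinearMap.range f).mkQ_surjective.comp p.mkQ_surjective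
        have hlt : p < LinearMap.ker q := by
          refine lt_of_le_of_ne (fun x hx => ?_) fun h => hf ?_
          · have : p.mkQ x = 0 := by simpa using hx
            rw [LinearMap.mem_ker, LinearMap.comp_apply, this, map_zero]
          · ext u
            obtain ⟨v, hv⟩ := p.mkQ_surjective (f u)
            have : v ∈ p := by
              rw [h, LinearMap.mem_ker, LinearMap.comp_apply, hv]
              simp
            rw [← hv]
            simpa using this
        exact (ih _ hlt).of_surjective (q.quotKerEquivOfSurjective hq).toLinearMap
          (q.quotKerEquivOfSurjective hq).surjective
      have hinj : Function.Injective (pre (V ⧸ p)) := by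
        rw [← LinearMap.ker_eq_bot, LinearMap.ker_eq_bot']
        intro g hg
        have hker : LinearMap.ker π ≤ LinearMap.ker g := by
          rw [← hd]
          rintro _ ⟨x, rfl⟩
          exact LinearMap.congr_fun hg x
        have h0 := hzero ((LinearMap.ker π).liftQ g hker ∘ₗ
          (π.quotKerEquivOfSurjective hπ).symm.toLinearMap)
        ext x
        have h1 := LinearMap.congr_fun h0 (π x)
        have : (π.quotKerEquivOfSurjective hπ).symm (π x) = (LinearMap.ker π).mkQ x := by
          rw [LinearEquiv.symm_apply_eq]
          simp
        simpa [this] using h1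
      have hmem : (fun i => ((dimVec A S (V ⧸ p) i : ℕ) : ℝ)) ∈ newtonPolytope A S U := by
        rw [hNewton]
        exact subset_convexHull ℝ _ ⟨p, rfl⟩
      have hle := hNU hmem
      rw [Set.mem_ofPred_eq, hℓ, sub_nonneg, Nat.cast_le] at hle
      have := finite_linearMap_of_finite (A := A) (K := K) (P := P₀) (V ⧸ p)
      have := finite_linearMap_of_finite (A := A) (K := K) (P := P₁) (V ⧸ p)
      exact hp ((LinearMap.injective_iff_surjective_of_finrank_eq_finrank
        (le_antisymm (LinearMap.finrank_le_finrank_of_injective hinj) hle)).1 hinj)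
  exact (hV ⊥).of_surjective (Submodule.quotEquivOfEqBot ⊥ rfl).toLinearMap
    (Submodule.quotEquivOfEqBot ⊥ rfl).surjective

/-- Maps from a τ-rigid module `U` lift along extensions with kernel in `Fac (U ⊕ V)`, for every
`V` with the same Newton polytope as `U`. -/
theorem IsTauRigid.exists_lift_of_newtonPolytope_eq {A : Type} [Ring A] (K : Type) [Field K]
    [Algebra K A] [FiniteDimensional K A] {n : ℕ} {S : Fin n → ModuleCat.{0} A}
    (hdistinct : ∀ i j, Nonempty ((S i : Type) ≃ₗ[A] (S j : Type)) → i = j)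
    (hcomplete : ∀ M : ModuleCat.{0} A, IsSimpleModule A M → ∃ i, Nonempty (M ≃ₗ[A] S i))
    {U V : ModuleCat.{0} A} [Module.Finite A U] [Module.Finite A V] (hU : IsTauRigid A U)
    (hNewton : newtonPolytope A S U = newtonPolytope A S V)
    {X E W : ModuleCat.{0} A} (hX : X ∈ Fac A (ModuleCat.of A (U × V)))
    {f : X →ₗ[A] E} {g : E →ₗ[A] W} (hf : Function.Injective f) (hg : Function.Surjective g)
    (hfg : LinearMap.range f = LinearMap.ker g) (φ : U →ₗ[A] W) :
    ∃ s : U →ₗ[A] E, g ∘ₗ s = φ := by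
  have : IsArtinianRing A := IsArtinianRing.of_finite K A
  obtain ⟨m, π, hπ⟩ := Module.Finite.exists_fin' A U
  obtain ⟨P₁, _, _, ρ, hρ, hmin⟩ := exists_projective_cover (A := A) (LinearMap.ker π)
  let d := (LinearMap.ker π).subtype ∘ₗ ρ
  have hd : LinearMap.range d = LinearMap.ker π := by
    rw [LinearMap.range_comp, LinearMap.range_eq_top.2 hρ, Submodule.map_top,
      Submodule.range_subtype]
  have hker : LinearMap.ker d = LinearMap.ker ρ :=
    LinearMap.ker_comp_of_ker_eq_bot _ (Submodule.ker_subtype _)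
  have hUd : ExtendsAlong U d := hU.extendsAlong hπ hd (hker ▸ hmin)
  have hVd : ExtendsAlong V d :=
    ExtendsAlong.of_newtonPolytope_eq (K := K) hdistinct hcomplete hNewton hπ hd hUd
  exact ExtendsAlong.exists_lift (ExtendsAlong.of_mem_Fac (hUd.prod hVd) hX) hπ hd hf hg hfg φ

/-- if `U` and `V` are τ-rigid with the same Newton polytope, then `U ⊕ V` is
τ-rigid. -/
theorem tauRigid_prod_of_newtonPolytope_eq (A : Type) [Ring A]
    (K : Type) [Field K] [Algebra K A] [FiniteDimensional K A]
    (n : ℕ) (S : Fin n → ModuleCat.{0} A)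
    (hsimple : ∀ i, IsSimpleModule A (S i))
    (hdistinct : ∀ i j, Nonempty ((S i : Type) ≃ₗ[A] (S j : Type)) → i = j)
    (hcomplete : ∀ M : ModuleCat.{0} A, IsSimpleModule A M → ∃ i, Nonempty (M ≃ₗ[A] S i))
    (U V : ModuleCat.{0} A) (hU : Module.Finite A U) (hV : Module.Finite A V)
    (hUr : IsTauRigid A U) (hVr : IsTauRigid A V)
    (hNewton : newtonPolytope A S U = newtonPolytope A S V) :
    IsTauRigid A (ModuleCat.of A (↥U × ↥V)) := by
  intro X hX E f g hf hg hfg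
  have hX' : X ∈ Fac A (ModuleCat.of A (V × U)) := by
    obtain ⟨k, q, hq⟩ := hX
    let e : (Fin k → V × U) ≃ₗ[A] (Fin k → U × V) :=
      LinearEquiv.piCongrRight fun _ => LinearEquiv.prodComm A V U
    exact ⟨k, q ∘ₗ e.toLinearMap, hq.comp e.surjective⟩
  obtain ⟨s, hs⟩ := hUr.exists_lift_of_newtonPolytope_eq K hdistinct hcomplete hNewton hX hf hg hfg
    (LinearMap.inl A U V)
  obtain ⟨t, ht⟩ := hVr.exists_lift_of_newtonPolytope_eq K hdistinct hcomplete hNewton.symm hX'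
    hf hg hfg (LinearMap.inr A U V)
  refine ⟨s.coprod t, ?_⟩
  rw [LinearMap.comp_coprod, hs, ht]
  exact LinearMap.coprod_inl_inr
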